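/- arXiv:2103.12904 — 9 statements merged into one kernel-verified Lean document; each statement's English description precedes it below -/
import Mathlib

section
/- Let X be a normed vector space over ℝ or ℂ and T : X → X a bounded linear operator. If x ∈ X is a chain recurrent point of T, then every point of span[x] = {λ x : λ scalar} is a chain recurrent point of T, and moreover for any scalars λ, μ the points λx and μx belong to the same chain recurrent class, i.e., for every ε > 0 there is an ε-chain from λx to μx and an ε-chain from μx to λx. -/
/-- An `ε`-chain of `T` from `x` to `y`: a finite sequence `x = c 0, c 1, …, c n = y`
with `n ≥ 1` such that `‖T (c i) - c (i+1)‖ < ε` for every `0 ≤ i < n`. -/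
def EpsChain {E : Type*} [NormedAddCommGroup E] (T : E → E) (ε : ℝ) (x y : E) : Prop :=
  ∃ (n : ℕ) (c : ℕ → E), 1 ≤ n ∧ c 0 = x ∧ c n = y ∧ ∀ i < n, ‖T (c i) - c (i + 1)‖ < ε

/-- `x` is a chain recurrent point of `T` if for every `ε > 0` there is an `ε`-chain
beginning and ending at `x`. -/
def ChainRecurrent {E : Type*} [NormedAddCommGroup E] (T : E → E) (x : E) : Prop :=
  ∀ ε > 0, EpsChain T ε x x

/-- A chain from `x` to itself can be repeated periodically, giving a bounded infinite chain. -/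
lemma EpsChain.exists_periodic {E : Type*} [NormedAddCommGroup E] {T : E → E} {ε : ℝ} {x : E}
    (h : EpsChain T ε x x) :
    ∃ (n : ℕ) (c : ℕ → E) (M : ℝ), 1 ≤ n ∧ (∀ k, c (k * n) = x) ∧ (∀ i, ‖c i‖ ≤ M) ∧
      ∀ i, ‖T (c i) - c (i + 1)‖ < ε := by
  obtain ⟨n, c, hn, h0, hcn, hc⟩ := h
  refine ⟨n, fun i => c (i % n), ∑ j ∈ Finset.range n, ‖c j‖, hn, fun k => by simp [h0],
    fun i => ?_, fun i => ?_⟩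
  · exact Finset.single_le_sum (f := fun j => ‖c j‖) (fun _ _ => norm_nonneg _)
      (Finset.mem_range.2 (Nat.mod_lt i hn))
  · have hlt : i % n < n := Nat.mod_lt i hn
    have hstep : c ((i + 1) % n) = c (i % n + 1) := by
      rw [← Nat.mod_add_mod]
      rcases Nat.lt_or_ge (i % n + 1) n with h | h
      · rw [Nat.mod_eq_of_lt h]
      · rw [show i % n + 1 = n by omega, Nat.mod_self, h0, hcn]
    simpa only [hstep] using hc _ hlt

/-- Multiplying a periodic chain through `x` by slowly varying scalars connects any two multiples
of `x`. -/
lemma ChainRecurrent.epsChain_smul_smul {𝕜 : Type*} [RCLike 𝕜] {X : Type*} [NormedAddCommGroup X]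
    [NormedSpace 𝕜 X] {T : X →L[𝕜] X} {x : X} (hx : ChainRecurrent (⇑T) x) (lam mu : 𝕜)
    {ε : ℝ} (hε : 0 < ε) : EpsChain (⇑T) ε (lam • x) (mu • x) := by
  set R : ℝ := ‖lam‖ + ‖mu - lam‖ + 1 with hR
  have hRpos : 0 < R := by positivity
  obtain ⟨n, c, M, hn, hcx, hM, hc⟩ := (hx (ε / (2 * R)) (by positivity)).exists_periodic
  have hM0 : 0 ≤ M := (norm_nonneg _).trans (hM 0)
  obtain ⟨k, hk⟩ := exists_nat_gt (‖mu - lam‖ * M / (ε / 2))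
  have hk0 : (0 : ℝ) < k := lt_of_le_of_lt (by positivity) hk
  have hkn : 1 ≤ k * n := Nat.mul_pos (by exact_mod_cast hk0) hn
  set N := k * n with hN
  have hNpos : (0 : ℝ) < N := by exact_mod_cast hkn
  have hNne : (N : 𝕜) ≠ 0 := by exact_mod_cast (by omega : N ≠ 0)
  have hkN : (k : ℝ) ≤ N := by exact_mod_cast Nat.le_mul_of_pos_right k hn
  set a : ℕ → 𝕜 := fun i => lam + (i / N : 𝕜) * (mu - lam) with ha
  have ha_norm : ∀ i < N, ‖a i‖ ≤ R := fun i hi => by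
    have h1 : ‖(i / N : 𝕜)‖ ≤ 1 := by
      rw [norm_div, RCLike.norm_natCast, RCLike.norm_natCast, div_le_one hNpos]
      exact_mod_cast hi.le
    calc ‖a i‖ ≤ ‖lam‖ + ‖(i / N : 𝕜)‖ * ‖mu - lam‖ :=
          (norm_add_le _ _).trans_eq (by rw [norm_mul])
      _ ≤ R := by nlinarith [norm_nonneg (mu - lam)]
  have ha_diff : ∀ i, ‖a i - a (i + 1)‖ * M < ε / 2 := fun i => by
    have h1 : a i - a (i + 1) = -((mu - lam) / N) := by
      simp only [ha]; push_cast; field_simp; ring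
    rw [h1, norm_neg, norm_div, RCLike.norm_natCast, div_mul_eq_mul_div, div_lt_iff₀ hNpos]
    rw [div_lt_iff₀ (by positivity)] at hk
    nlinarith
  refine ⟨N, fun i => a i • c i, hkn, ?_, ?_, fun i hi => ?_⟩
  · simpa [ha] using congrArg (lam • ·) (hcx 0)
  · simp [ha, hNne, hN ▸ hcx k]
  · have hsplit : T (a i • c i) - a (i + 1) • c (i + 1) =
        a i • (T (c i) - c (i + 1)) + (a i - a (i + 1)) • c (i + 1) := by
      rw [map_smul, smul_sub, sub_smul]; abel
    have h1 : ‖a i‖ * ‖T (c i) - c (i + 1)‖ ≤ R * (ε / (2 * R)) :=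
      mul_le_mul (ha_norm i hi) (hc i).le (norm_nonneg _) hRpos.le
    have h2 : R * (ε / (2 * R)) = ε / 2 := by field_simp
    have h3 : ‖a i - a (i + 1)‖ * ‖c (i + 1)‖ ≤ ‖a i - a (i + 1)‖ * M :=
      mul_le_mul_of_nonneg_left (hM _) (norm_nonneg _)
    calc ‖T (a i • c i) - a (i + 1) • c (i + 1)‖
        ≤ ‖a i‖ * ‖T (c i) - c (i + 1)‖ + ‖a i - a (i + 1)‖ * ‖c (i + 1)‖ := by
          rw [hsplit, ← norm_smul, ← norm_smul]; exact norm_add_le _ _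
      _ < ε := by linarith [ha_diff i]

theorem stmt_0 {𝕜 : Type*} [RCLike 𝕜] {X : Type*} [NormedAddCommGroup X] [NormedSpace 𝕜 X]
    (T : X →L[𝕜] X) (x : X) (hx : ChainRecurrent (⇑T) x) :
    (∀ lam : 𝕜, ChainRecurrent (⇑T) (lam • x)) ∧
    (∀ lam mu : 𝕜, ∀ ε > 0,
      EpsChain (⇑T) ε (lam • x) (mu • x) ∧ EpsChain (⇑T) ε (mu • x) (lam • x)) :=
  ⟨fun lam _ hε => hx.epsChain_smul_smul lam lam hε, fun lam mu _ hε =>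
    ⟨hx.epsChain_smul_smul lam mu hε, hx.epsChain_smul_smul mu lam hε⟩⟩
end

section
/- Let X be a normed vector space over ℝ or ℂ and T : X → X a bounded linear operator which is a surjective isometry. Then T is chain transitive, i.e., every point of X is a chain recurrent point of T. In particular, every unitary operator on an inner product space is chain transitive. -/
theorem EpsChain.trans {E : Type*} [NormedAddCommGroup E] {T : E → E} {ε : ℝ} {x y z : E}
    (hxy : EpsChain T ε x y) (hyz : EpsChain T ε y z) : EpsChain T ε x z := by
  obtain ⟨n, c, hn, hc0, hcn, hc⟩ := hxy
  obtain ⟨m, d, -, hd0, hdm, hd⟩ := hyz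
  refine ⟨n + m, fun i => if i < n then c i else d (i - n), by omega, ?_, by simpa using hdm, ?_⟩
  · simpa [show 0 < n by omega] using hc0
  intro i hi
  rcases lt_trichotomy (i + 1) n with h | h | h
  · simpa [h, show i < n by omega] using hc i (by omega)
  · have := hc i (by omega)
    rw [h, hcn, ← hd0] at this
    simpa [h, show i < n by omega] using this
  · have := hd (i - n) (by omega)
    rw [← Nat.sub_add_comm (show n ≤ i by omega)] at this
    simpa [show ¬ i + 1 < n by omega, show ¬ i < n by omega] using this

theorem norm_iterate_of_norm_map {E : Type*} [Norm E] {T : E → E}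
    (hT : ∀ x, ‖T x‖ = ‖x‖) (n : ℕ) (x : E) : ‖T^[n] x‖ = ‖x‖ := by
  induction n with
  | zero => rfl
  | succ n ih => rw [Function.iterate_succ_apply', hT, ih]

/-- Rescaling the orbit of `z` under an isometry by slowly varying scalars gives a chain. -/
theorem epsChain_smul_iterate {𝕜 : Type*} [RCLike 𝕜] {X : Type*} [NormedAddCommGroup X]
    [NormedSpace 𝕜 X] (T : X →L[𝕜] X) (hiso : ∀ x : X, ‖T x‖ = ‖x‖) {ε : ℝ} (z : X)
    (a : ℕ → 𝕜) {n : ℕ} (hn : 1 ≤ n) (ha : ∀ i < n, ‖a i - a (i + 1)‖ * ‖z‖ < ε) :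
    EpsChain T ε (a 0 • z) (a n • T^[n] z) := by
  refine ⟨n, fun i => a i • T^[i] z, hn, rfl, rfl, fun i hi => ?_⟩
  rw [map_smul, ← Function.iterate_succ_apply' T, ← sub_smul, norm_smul,
    norm_iterate_of_norm_map hiso]
  exact ha i hi

theorem stmt_4 {𝕜 : Type*} [RCLike 𝕜] {X : Type*} [NormedAddCommGroup X] [NormedSpace 𝕜 X]
    (T : X →L[𝕜] X) (hsurj : Function.Surjective (⇑T)) (hiso : ∀ x : X, ‖T x‖ = ‖x‖) :
    ∀ x : X, ChainRecurrent (⇑T) x := by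
  intro x ε hε
  obtain ⟨N, hN⟩ := exists_nat_gt (‖x‖ / ε)
  have hN0 : (0 : ℝ) < N := (by positivity : 0 ≤ ‖x‖ / ε).trans_lt hN
  have hN1 : 1 ≤ N := by exact_mod_cast hN0
  have hNk : (N : 𝕜) ≠ 0 := by exact_mod_cast hN0.ne'
  have hsmall : ‖(N : 𝕜)⁻¹‖ * ‖x‖ < ε := by
    rw [norm_inv, RCLike.norm_natCast, inv_mul_lt_iff₀ hN0]
    exact (div_lt_iff₀ hε).1 hN
  obtain ⟨y, hy⟩ := hsurj.iterate N x
  have hyx : ‖y‖ = ‖x‖ := by rw [← hy, norm_iterate_of_norm_map hiso]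
  have h₁ : EpsChain T ε x 0 := by
    have := epsChain_smul_iterate T hiso x (fun i => 1 - (N : 𝕜)⁻¹ * i) hN1 (ε := ε) fun i _ => by
      convert hsmall using 3
      push_cast
      ring
    simpa [hNk] using this
  have h₂ : EpsChain T ε 0 x := by
    have := epsChain_smul_iterate T hiso y (fun i => (N : 𝕜)⁻¹ * i) hN1 (ε := ε) fun i _ => by
      have hstep : (N : 𝕜)⁻¹ * i - (N : 𝕜)⁻¹ * (i + 1 : ℕ) = -(N : 𝕜)⁻¹ := by
        push_cast
        ring
      rwa [hstep, norm_neg, hyx]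
    simpa [hNk, hy] using this
  exact h₁.trans h₂
end

section
/- Let X be a normed vector space over ℝ or ℂ and T : X → X a bounded linear operator that is invertible with bounded inverse T⁻¹. Then CR(T) = CR(T⁻¹): a point x is chain recurrent for T if and only if it is chain recurrent for T⁻¹. -/
/-- Reversing an `ε`-chain of `T` gives an `ε'`-chain of `T⁻¹` as soon as `‖T⁻¹‖ * ε < ε'`. -/
theorem EpsChain.reverse {𝕜 : Type*} [RCLike 𝕜] {X : Type*} [NormedAddCommGroup X]
    [NormedSpace 𝕜 X] (T : X ≃L[𝕜] X) {ε ε' : ℝ} {x y : X} (h : EpsChain (⇑T) ε x y)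
    (hε : ‖(T.symm : X →L[𝕜] X)‖ * ε < ε') : EpsChain (⇑T.symm) ε' y x := by
  obtain ⟨n, c, hn, h0, h1, hc⟩ := h
  refine ⟨n, fun i => c (n - i), hn, by simpa using h1, by simpa using h0, fun i hi => ?_⟩
  have hstep := hc (n - (i + 1)) (by omega)
  rw [show n - (i + 1) + 1 = n - i by omega] at hstep
  calc ‖T.symm (c (n - i)) - c (n - (i + 1))‖
      = ‖(T.symm : X →L[𝕜] X) (c (n - i) - T (c (n - (i + 1))))‖ := by simp
    _ ≤ ‖(T.symm : X →L[𝕜] X)‖ * ‖c (n - i) - T (c (n - (i + 1)))‖ :=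
        ContinuousLinearMap.le_opNorm _ _
    _ ≤ ‖(T.symm : X →L[𝕜] X)‖ * ε := by
        rw [norm_sub_rev]
        gcongr
    _ < ε' := hε

theorem ChainRecurrent.symm {𝕜 : Type*} [RCLike 𝕜] {X : Type*} [NormedAddCommGroup X]
    [NormedSpace 𝕜 X] (T : X ≃L[𝕜] X) {x : X} (h : ChainRecurrent (⇑T) x) :
    ChainRecurrent (⇑T.symm) x := by
  intro ε hε
  have hpos : 0 < ‖(T.symm : X →L[𝕜] X)‖ + 1 := by positivity
  refine (h (ε / (‖(T.symm : X →L[𝕜] X)‖ + 1)) (by positivity)).reverse T ?_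
  rw [← mul_div_assoc, div_lt_iff₀ hpos]
  linarith

theorem stmt_6 {𝕜 : Type*} [RCLike 𝕜] {X : Type*} [NormedAddCommGroup X] [NormedSpace 𝕜 X]
    (T : X ≃L[𝕜] X) (x : X) :
    ChainRecurrent (⇑T) x ↔ ChainRecurrent (⇑T.symm) x :=
  ⟨ChainRecurrent.symm T, ChainRecurrent.symm T.symm⟩
end

section
/- Let X be a normed vector space over ℝ or ℂ and T : X → X a bounded linear operator which is a proper dilation, i.e., T is invertible with bounded inverse and ‖T⁻¹‖ < 1. Then the chain recurrent set of T is {0}. -/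
/-- If `T⁻¹` is a contraction, balls around `0` are backward invariant under `ε`-chains of `T`
for `ε` small compared to the radius, and such chains start strictly inside the ball. -/
theorem EpsChain.norm_lt {𝕜 : Type*} [RCLike 𝕜] {X : Type*} [NormedAddCommGroup X]
    [NormedSpace 𝕜 X] {T : X ≃L[𝕜] X} (hT : ‖(T.symm : X →L[𝕜] X)‖ < 1) {R : ℝ} (hR : 0 < R)
    {x y : X} (h : EpsChain T ((1 - ‖(T.symm : X →L[𝕜] X)‖) * R) x y) (hy : ‖y‖ ≤ R) :
    ‖x‖ < R := by
  obtain ⟨n, c, hn, rfl, rfl, hc⟩ := h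
  set r := ‖(T.symm : X →L[𝕜] X)‖
  have hr : 0 ≤ r := norm_nonneg _
  have step : ∀ i < n, ‖c (i + 1)‖ ≤ R → ‖c i‖ < R := by
    intro i hi hle
    have h₁ : ‖c i‖ ≤ r * ‖T (c i)‖ := by
      simpa using (T.symm : X →L[𝕜] X).le_opNorm (T (c i))
    have h₂ : ‖T (c i)‖ ≤ R + (1 - r) * R := by
      linarith [norm_sub_norm_le (T (c i)) (c (i + 1)), hc i hi]
    have h₃ : 0 < (1 - r) ^ 2 * R := mul_pos (pow_pos (sub_pos.2 hT) 2) hR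
    linarith [mul_le_mul_of_nonneg_left h₂ hr]
  have bound : ∀ k ≤ n, ‖c (n - k)‖ ≤ R := by
    intro k
    induction k with
    | zero => simpa using hy
    | succ k ih =>
      intro hk
      refine (step (n - (k + 1)) (by omega) ?_).le
      rw [show n - (k + 1) + 1 = n - k by omega]
      exact ih (by omega)
  refine step 0 hn ?_
  simpa [show n - (n - 1) = 1 by omega] using bound (n - 1) (Nat.sub_le n 1)

theorem stmt_7 {𝕜 : Type*} [RCLike 𝕜] {X : Type*} [NormedAddCommGroup X] [NormedSpace 𝕜 X]
    (T : X ≃L[𝕜] X) (hT : ‖(T.symm : X →L[𝕜] X)‖ < 1) :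
    {x | ChainRecurrent (⇑T) x} = {0} := by
  ext x
  refine ⟨fun hx => ?_, ?_⟩
  · by_contra hne
    have hpos : 0 < ‖x‖ := norm_pos_iff.2 hne
    exact lt_irrefl _ ((hx _ (mul_pos (sub_pos.2 hT) hpos)).norm_lt hT hpos le_rfl)
  · rintro rfl ε hε
    exact ⟨1, fun _ => 0, le_rfl, rfl, rfl, fun _ _ => by simpa using hε⟩
end

section
/- Let X be a Banach space over ℝ or ℂ and T : X → X a bounded linear operator. Suppose X = M ⊕ N where M and N are closed T-invariant linear subspaces of X (every x ∈ X is uniquely x = m + n with m ∈ M, n ∈ N). Then CR(T) ∩ M = CR(T|_M), where T|_M : M → M is the restriction of T to M. -/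
/-- Chain recurrence is pushed forward by a continuous linear semiconjugacy. -/
theorem ChainRecurrent.map {𝕜 E F : Type*} [NontriviallyNormedField 𝕜]
    [NormedAddCommGroup E] [NormedSpace 𝕜 E] [NormedAddCommGroup F] [NormedSpace 𝕜 F]
    {S : E → E} {R : F → F} (P : E →L[𝕜] F) (hP : Function.Semiconj P S R) {x : E}
    (hx : ChainRecurrent S x) : ChainRecurrent R (P x) := by
  intro ε hε
  have hK : 0 < ‖P‖ + 1 := by positivity
  obtain ⟨n, c, hn, h0, hcn, hc⟩ := hx (ε / (‖P‖ + 1)) (by positivity)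
  refine ⟨n, fun i => P (c i), hn, by simp [h0], by simp [hcn], fun i hi => ?_⟩
  calc ‖R (P (c i)) - P (c (i + 1))‖ = ‖P (S (c i) - c (i + 1))‖ := by
        rw [map_sub, hP.eq]
    _ ≤ ‖P‖ * ‖S (c i) - c (i + 1)‖ := P.le_opNorm _
    _ ≤ (‖P‖ + 1) * ‖S (c i) - c (i + 1)‖ := by gcongr; linarith
    _ < (‖P‖ + 1) * (ε / (‖P‖ + 1)) := by gcongr; exact hc i hi
    _ = ε := by field_simp

theorem stmt_8 {𝕜 : Type*} [RCLike 𝕜] {X : Type*} [NormedAddCommGroup X] [NormedSpace 𝕜 X]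
    [CompleteSpace X] (T : X →L[𝕜] X) (M N : Submodule 𝕜 X)
    (hMc : IsClosed (M : Set X)) (hNc : IsClosed (N : Set X))
    (hMi : ∀ x ∈ M, T x ∈ M) (hNi : ∀ x ∈ N, T x ∈ N)
    (hcompl : IsCompl M N) :
    ∀ x : M, (ChainRecurrent (⇑T) (x : X) ↔
      ChainRecurrent (fun m : M => (⟨T m, hMi m m.2⟩ : M)) x) := by
  intro x
  have hMN : M.IsTopCompl N := Submodule.IsCompl.isTopCompl_of_isClosed hcompl hMc hNc
  constructor
  · intro hx
    rw [← M.projectionOntoL_apply_left hMN x]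
    refine hx.map (M.projectionOntoL N hMN) fun y => ?_
    obtain ⟨m, hm, n, hn, rfl⟩ := Submodule.mem_sup.1
      (hcompl.sup_eq_top ▸ Submodule.mem_top : y ∈ M ⊔ N)
    have hleft {z : X} (hz : z ∈ M) : M.projectionOntoL N hMN z = ⟨z, hz⟩ :=
      M.projectionOntoL_apply_left hMN ⟨z, hz⟩
    have hright {z : X} (hz : z ∈ N) : M.projectionOntoL N hMN z = 0 :=
      (M.projectionOntoL_apply_eq_zero_iff hMN).2 hz
    simp only [map_add, hleft hm, hleft (hMi m hm), hright hn, hright (hNi n hn), add_zero]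
  · exact fun hx => hx.map M.subtypeL fun _ => rfl
end

section
/- Let X be a Banach space over ℝ or ℂ and T : X → X a hyperbolic bounded linear operator, i.e., X = B_s ⊕ B_u with B_s, B_u closed T-invariant linear subspaces, T|_{B_s} a proper contraction (‖T|_{B_s}‖ < 1) and T|_{B_u} a proper dilation (invertible on B_u with ‖(T|_{B_u})⁻¹‖ < 1). Then the chain recurrent set of T is {0}. -/
/-- A finite real sequence with equal endpoints satisfying `a (i + 1) ≤ k * a i + δ` starts below
the fixed point `δ / (1 - k)`. -/
theorem le_div_one_sub_of_affine_recurrence {k δ : ℝ} (hk0 : 0 ≤ k) (hk1 : k < 1) {n : ℕ}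
    (hn : 1 ≤ n) {a : ℕ → ℝ} (hper : a n = a 0) (ha : ∀ i < n, a (i + 1) ≤ k * a i + δ) :
    a 0 ≤ δ / (1 - k) := by
  have hk : 0 < 1 - k := sub_pos.2 hk1
  set M := δ / (1 - k) with hM
  have hδ : δ = M - k * M := by rw [hM]; field_simp
  have hbound : ∀ i ≤ n, a i - M ≤ k ^ i * (a 0 - M) := by
    intro i
    induction i with
    | zero => simp
    | succ i ih =>
      intro hi
      have h1 := mul_le_mul_of_nonneg_left (ih (by omega)) hk0
      have h2 := ha i hi
      rw [pow_succ']
      linarith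
  have h := hbound n le_rfl
  have hkn : k ^ n < 1 := pow_lt_one₀ hk0 hk1 (by omega)
  rw [hper] at h
  by_contra! hlt
  nlinarith [mul_pos (sub_pos.2 hkn) (sub_pos.2 hlt)]

section

variable {𝕜 : Type*} [RCLike 𝕜] {X : Type*} [NormedAddCommGroup X] [NormedSpace 𝕜 X]

/-- A continuous linear map commuting with `T` sends chain recurrent points to chain recurrent
points, through chains contained in its range. -/
theorem ChainRecurrent.exists_chain_range {T P : X →L[𝕜] X} (hcomm : ∀ x, P (T x) = T (P x))
    {x : X} (hx : ChainRecurrent T x) {ε : ℝ} (hε : 0 < ε) :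
    ∃ (n : ℕ) (c : ℕ → X), 1 ≤ n ∧ P (c 0) = P x ∧ P (c n) = P x ∧
      ∀ i < n, ‖T (P (c i)) - P (c (i + 1))‖ < ε := by
  have hC : 0 < ‖P‖ + 1 := by positivity
  obtain ⟨n, c, hn, h0, h1, hc⟩ := hx (ε / (‖P‖ + 1)) (by positivity)
  refine ⟨n, c, hn, by rw [h0], by rw [h1], fun i hi ↦ ?_⟩
  rw [← hcomm, ← map_sub]
  calc ‖P (T (c i) - c (i + 1))‖ ≤ ‖P‖ * ‖T (c i) - c (i + 1)‖ := P.le_opNorm _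
    _ ≤ (‖P‖ + 1) * ‖T (c i) - c (i + 1)‖ := by gcongr; linarith
    _ < (‖P‖ + 1) * (ε / (‖P‖ + 1)) := by gcongr; exact hc i hi
    _ = ε := by field_simp

theorem eq_zero_of_forall_norm_le_div {E : Type*} [NormedAddCommGroup E] {k : ℝ} (hk1 : k < 1)
    {y : E} (h : ∀ ε > 0, ‖y‖ ≤ ε / (1 - k)) : y = 0 := by
  have hk : 0 < 1 - k := sub_pos.2 hk1
  refine norm_le_zero_iff.1 (le_of_forall_pos_le_add fun ε hε ↦ ?_)
  have := h (ε * (1 - k)) (by positivity)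
  rwa [mul_div_cancel_right₀ _ hk.ne', ← zero_add ε] at this

theorem ChainRecurrent.map_eq_zero_of_contraction {T P : X →L[𝕜] X}
    (hcomm : ∀ x, P (T x) = T (P x)) {k : ℝ} (hk0 : 0 ≤ k) (hk1 : k < 1)
    (hcontr : ∀ x, ‖T (P x)‖ ≤ k * ‖P x‖) {x : X} (hx : ChainRecurrent T x) : P x = 0 := by
  refine eq_zero_of_forall_norm_le_div hk1 fun ε hε ↦ ?_
  obtain ⟨n, c, hn, h0, h1, hc⟩ := hx.exists_chain_range hcomm hε
  rw [← h0]
  refine le_div_one_sub_of_affine_recurrence (a := fun i ↦ ‖P (c i)‖) hk0 hk1 hn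
    (by simp only [h0, h1]) fun i hi ↦ ?_
  have := norm_le_norm_add_norm_sub (T (P (c i))) (P (c (i + 1)))
  linarith [hc i hi, hcontr (c i)]

theorem ChainRecurrent.map_eq_zero_of_dilation {T P : X →L[𝕜] X}
    (hcomm : ∀ x, P (T x) = T (P x)) {k : ℝ} (hk0 : 0 ≤ k) (hk1 : k < 1)
    (hdil : ∀ x, ‖P x‖ ≤ k * ‖T (P x)‖) {x : X} (hx : ChainRecurrent T x) : P x = 0 := by
  refine eq_zero_of_forall_norm_le_div hk1 fun ε hε ↦ ?_
  obtain ⟨n, c, hn, h0, h1, hc⟩ := hx.exists_chain_range hcomm hε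
  have := le_div_one_sub_of_affine_recurrence (δ := ε) (a := fun i ↦ ‖P (c (n - i))‖) hk0 hk1 hn
    (by simp only [Nat.sub_self, Nat.sub_zero, h0, h1]) fun i hi ↦ ?_
  · simpa only [Nat.sub_zero, h1] using this
  · have hs : n - i = n - (i + 1) + 1 := by omega
    have hlt := hc (n - (i + 1)) (by omega)
    rw [← hs] at hlt
    have htri := norm_le_norm_add_norm_sub' (T (P (c (n - (i + 1))))) (P (c (n - i)))
    calc ‖P (c (n - (i + 1)))‖ ≤ k * ‖T (P (c (n - (i + 1))))‖ := hdil _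
      _ ≤ k * (‖P (c (n - i))‖ + ε) := by gcongr; linarith
      _ ≤ k * ‖P (c (n - i))‖ + ε := by nlinarith

/-- The projection onto an invariant submodule along an invariant complement commutes with the
operator. -/
theorem Submodule.projection_apply_comm {R M : Type*} [Ring R] [AddCommGroup M] [Module R M]
    {p q : Submodule R M} (h : IsCompl p q) (f : M →ₗ[R] M) (hp : ∀ x ∈ p, f x ∈ p)
    (hq : ∀ x ∈ q, f x ∈ q) (x : M) : p.projection q h (f x) = f (p.projection q h x) := by
  conv_lhs => rw [← projection_add_projection_eq_self h x, map_add, map_add]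
  rw [projection_apply_of_mem_left h (hp _ (projection_apply_mem h x)),
    (projection_apply_eq_zero_iff h).2 (hq _ (projection_apply_mem h.symm x)), add_zero]

end

theorem stmt_11 {𝕜 : Type*} [RCLike 𝕜] {X : Type*} [NormedAddCommGroup X] [NormedSpace 𝕜 X]
    [CompleteSpace X] (T : X →L[𝕜] X) (Bs Bu : Submodule 𝕜 X)
    (hsc : IsClosed (Bs : Set X)) (huc : IsClosed (Bu : Set X))
    (hsi : ∀ x ∈ Bs, T x ∈ Bs) (hui : ∀ x ∈ Bu, T x ∈ Bu)
    (hcompl : IsCompl Bs Bu)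
    -- the restriction of T to Bs is a proper contraction
    (hcontr : ∃ k : ℝ, k < 1 ∧ ∀ x ∈ Bs, ‖T x‖ ≤ k * ‖x‖)
    -- the restriction of T to Bu is a proper dilation: T maps Bu onto Bu and the
    -- inverse of the restriction has operator norm < 1
    (hdilsurj : ∀ y ∈ Bu, ∃ x ∈ Bu, T x = y)
    (hdil : ∃ k : ℝ, k < 1 ∧ ∀ x ∈ Bu, ‖x‖ ≤ k * ‖T x‖) :
    {x | ChainRecurrent (⇑T) x} = {0} := by
  ext x
  simp only [Set.mem_ofPred_eq, Set.mem_singleton_iff]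
  constructor
  · intro hx
    have htop := Submodule.IsCompl.isTopCompl_of_isClosed hcompl hsc huc
    obtain ⟨k, hk, hcontr⟩ := hcontr
    obtain ⟨l, hl, hdil⟩ := hdil
    have hs : Bs.projection Bu hcompl x = 0 := by
      refine hx.map_eq_zero_of_contraction (P := Bs.projectionL Bu htop) (k := max k 0)
        (Submodule.projection_apply_comm hcompl (T : X →ₗ[𝕜] X) hsi hui) (le_max_right _ _)
        (max_lt hk one_pos) fun y ↦ ?_
      refine (hcontr _ (Submodule.projection_apply_mem hcompl y)).trans ?_
      exact mul_le_mul_of_nonneg_right (le_max_left _ _) (norm_nonneg _)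
    have hu : Bu.projection Bs hcompl.symm x = 0 := by
      refine hx.map_eq_zero_of_dilation (P := Bu.projectionL Bs htop.symm) (k := max l 0)
        (Submodule.projection_apply_comm hcompl.symm (T : X →ₗ[𝕜] X) hui hsi) (le_max_right _ _)
        (max_lt hl one_pos) fun y ↦ ?_
      refine (hdil _ (Submodule.projection_apply_mem hcompl.symm y)).trans ?_
      exact mul_le_mul_of_nonneg_right (le_max_left _ _) (norm_nonneg _)
    rw [← Submodule.projection_add_projection_eq_self hcompl x, hs, hu, add_zero]
  · rintro rfl ε hε
    exact ⟨1, fun _ ↦ 0, le_rfl, rfl, rfl, fun i _ ↦ by simpa using hε⟩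
end

section
/- Let X be a separable Banach space over ℝ or ℂ and T : X → X a bounded linear operator that is hypercyclic (there exists x ∈ X whose orbit {T^n x : n ∈ ℕ} is dense in X) and has the positive shadowing property. Then T is frequently hypercyclic and topologically mixing. -/
/-- `T` has the positive shadowing property: for every `ε > 0` there is `δ > 0` such
that every positive `δ`-pseudo orbit `(x n)` (i.e. `‖T (x n) - x (n+1)‖ ≤ δ` for all `n`)
is `ε`-shadowed by some `z`, i.e. `‖x n - T^[n] z‖ < ε` for all `n`. -/
def PosShadowing {E : Type*} [NormedAddCommGroup E] (T : E → E) : Prop :=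
  ∀ ε > 0, ∃ δ > 0, ∀ x : ℕ → E, (∀ n : ℕ, ‖T (x n) - x (n + 1)‖ ≤ δ) →
    ∃ z : E, ∀ n : ℕ, ‖x n - T^[n] z‖ < ε

/-- The lower density of a set `A ⊆ ℕ`: `liminf_{N → ∞} #(A ∩ [1, N]) / N`. -/
noncomputable def lowerDensity (A : Set ℕ) : ℝ :=
  Filter.liminf (fun N : ℕ => ((A ∩ Set.Icc 1 N).ncard : ℝ) / N) Filter.atTop

open Filter Topology

/-- Every bounded perturbation of the orbit equation can be solved with a uniform bound. -/
theorem PosShadowing.exists_bounded_solution {X : Type*} [NormedAddCommGroup X] [NormedSpace ℝ X]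
    {T : X →L[ℝ] X} (hsh : PosShadowing (⇑T)) :
    ∃ K : ℝ, 0 < K ∧ ∀ (r : ℝ) (e : ℕ → X), 0 < r → (∀ n, ‖e n‖ ≤ r) →
      ∃ y : ℕ → X, (∀ n, ‖y n‖ ≤ K * r) ∧ ∀ n, T (y n) - y (n + 1) = e n := by
  obtain ⟨δ, hδ, h⟩ := hsh 1 one_pos
  refine ⟨δ⁻¹, inv_pos.2 hδ, fun r e hr he => ?_⟩
  have hδr : 0 < δ / r := div_pos hδ hr
  let x : ℕ → X := fun n => Nat.rec 0 (fun k xk => T xk - (δ / r) • e k) n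
  have hx : ∀ n, x (n + 1) = T (x n) - (δ / r) • e n := fun n => rfl
  obtain ⟨z, hz⟩ := h x (fun n => by
    rw [hx, sub_sub_cancel, norm_smul, Real.norm_of_nonneg hδr.le]
    calc δ / r * ‖e n‖ ≤ δ / r * r := by gcongr; exact he n
      _ = δ := by field_simp)
  refine ⟨fun n => (r / δ) • (x n - (⇑T)^[n] z), fun n => ?_, fun n => ?_⟩
  · rw [norm_smul, Real.norm_of_nonneg (div_pos hr hδ).le]
    calc r / δ * ‖x n - (⇑T)^[n] z‖ ≤ r / δ * 1 := by gcongr; exact (hz n).le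
      _ = δ⁻¹ * r := by field_simp
  · simp only [map_smul, map_sub, hx, Function.iterate_succ_apply']
    rw [← smul_sub, show T (x n) - T ((⇑T)^[n] z) - (T (x n) - (δ / r) • e n - T ((⇑T)^[n] z))
      = (δ / r) • e n by abel, smul_smul, show r / δ * (δ / r) = 1 by field_simp, one_smul]

/-- The orbit equation stays uniformly solvable after a small perturbation of the coefficients. -/
theorem exists_bounded_solution_of_near_one {X : Type*} [NormedAddCommGroup X] [NormedSpace ℝ X]
    [CompleteSpace X] {T : X →L[ℝ] X} {K : ℝ}
    (h : ∀ (r : ℝ) (e : ℕ → X), 0 < r → (∀ n, ‖e n‖ ≤ r) →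
      ∃ y : ℕ → X, (∀ n, ‖y n‖ ≤ K * r) ∧ ∀ n, T (y n) - y (n + 1) = e n)
    {t : ℕ → ℝ} {η : ℝ} (hηK : η * K ≤ 1 / 2) (ht : ∀ n, |t n - 1| ≤ η)
    {e : ℕ → X} (he : ∀ n, ‖e n‖ ≤ 1) :
    ∃ y : ℕ → X, (∀ n, ‖y n‖ ≤ 2 * K) ∧ ∀ n, T (y n) - t n • y (n + 1) = e n := by
  have h' : ∀ (r : ℝ) (e : ℕ → X), ∃ y : ℕ → X, 0 < r → (∀ n, ‖e n‖ ≤ r) →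
      (∀ n, ‖y n‖ ≤ K * r) ∧ ∀ n, T (y n) - y (n + 1) = e n := by
    intro r e
    by_cases hr : 0 < r ∧ ∀ n, ‖e n‖ ≤ r
    · obtain ⟨y, hy⟩ := h r e hr.1 hr.2
      exact ⟨y, fun _ _ => hy⟩
    · exact ⟨0, fun h1 h2 => absurd ⟨h1, h2⟩ hr⟩
  choose sol hsol using h'
  let E : ℕ → ℕ → X := fun j => Nat.rec e
    (fun j ej => fun n => (t n - 1) • sol ((1 / 2) ^ j) ej (n + 1)) j
  let Y : ℕ → ℕ → X := fun j => sol ((1 / 2) ^ j) (E j)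
  have hE0 : E 0 = e := rfl
  have hES : ∀ j n, E (j + 1) n = (t n - 1) • Y j (n + 1) := fun j n => rfl
  have hpow : ∀ j : ℕ, (0 : ℝ) < (1 / 2) ^ j := fun j => by positivity
  have hη : 0 ≤ η := (abs_nonneg _).trans (ht 0)
  have hE : ∀ j n, ‖E j n‖ ≤ (1 / 2) ^ j := by
    intro j
    induction j with
    | zero => simpa [hE0] using he
    | succ j ih =>
      intro n
      rw [hES, norm_smul, Real.norm_eq_abs]
      have h1 := (hsol _ _ (hpow j) ih).1 (n + 1)
      calc |t n - 1| * ‖Y j (n + 1)‖ ≤ η * (K * (1 / 2) ^ j) := by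
            gcongr
            exact ht n
        _ = η * K * (1 / 2) ^ j := by ring
        _ ≤ 1 / 2 * (1 / 2) ^ j := by gcongr
        _ = (1 / 2) ^ (j + 1) := by ring
  have hY : ∀ j n, ‖Y j n‖ ≤ K * (1 / 2) ^ j := fun j => (hsol _ _ (hpow j) (hE j)).1
  have hYeq : ∀ j n, T (Y j n) - Y j (n + 1) = E j n := fun j => (hsol _ _ (hpow j) (hE j)).2
  have hgeo : HasSum (fun j : ℕ => K * (1 / 2 : ℝ) ^ j) (K * 2) := hasSum_geometric_two.mul_left K
  have hsum : ∀ n, Summable fun j => Y j n := fun n =>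
    Summable.of_norm_bounded hgeo.summable (fun j => hY j n)
  refine ⟨fun n => ∑' j, Y j n, fun n => ?_, fun n => ?_⟩
  · rw [mul_comm]
    exact tsum_of_norm_bounded hgeo fun j => hY j n
  · have h1 : HasSum (fun j => E j n - E (j + 1) n)
        (T (∑' j, Y j n) - t n • ∑' j, Y j (n + 1)) := by
      convert ((hsum n).hasSum.mapL T).sub ((hsum (n + 1)).hasSum.const_smul (t n)) using 2 with j
      rw [hES, ← hYeq, sub_smul, one_smul]
      abel
    have hE_lim : Tendsto (fun j => E j n) atTop (𝓝 0) :=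
      squeeze_zero_norm (fun j => hE j n)
        (tendsto_pow_atTop_nhds_zero_of_lt_one (by norm_num) (by norm_num))
    have h2 : Tendsto (fun m => ∑ j ∈ Finset.range m, (E j n - E (j + 1) n)) atTop (𝓝 (e n)) := by
      simp only [Finset.sum_range_sub', hE0]
      simpa using hE_lim.const_sub (e n)
    exact tendsto_nhds_unique h1.tendsto_sum_nat h2

/-- A pseudo orbit whose errors are bounded by a slowly varying weight is shadowed
with accuracy proportional to that weight. -/
theorem PosShadowing.exists_weighted_shadowing {X : Type*} [NormedAddCommGroup X]
    [NormedSpace ℝ X] [CompleteSpace X] {T : X →L[ℝ] X} (hsh : PosShadowing (⇑T)) :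
    ∃ μ K : ℝ, 1 < μ ∧ 0 < K ∧ ∀ (x : ℕ → X) (a : ℕ → ℝ), (∀ n, 0 < a n) →
      (∀ n, a (n + 1) ≤ μ * a n) → (∀ n, a n ≤ μ * a (n + 1)) →
      (∀ n, ‖T (x n) - x (n + 1)‖ ≤ a n) →
      ∃ z : X, ∀ n, ‖x n - (⇑T)^[n] z‖ ≤ K * a n := by
  obtain ⟨K, hK, h⟩ := hsh.exists_bounded_solution
  set η : ℝ := 1 / (2 * K) with hη
  have hη0 : 0 < η := by positivity
  refine ⟨1 + η, 2 * K, by linarith, by positivity, fun x a ha hup hdown hx => ?_⟩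
  obtain ⟨v, hv, hveq⟩ := exists_bounded_solution_of_near_one h (η := η)
    (t := fun n => a (n + 1) / a n) (e := fun n => (a n)⁻¹ • (T (x n) - x (n + 1)))
    (by rw [hη]; field_simp; norm_num)
    (fun n => by
      have h1 : a (n + 1) / a n - 1 = (a (n + 1) - a n) / a n := by
        have := (ha n).ne'
        field_simp
      rw [h1, abs_div, abs_of_pos (ha n), div_le_iff₀ (ha n), abs_le]
      have := hup n
      have := hdown n
      have := ha n
      have := ha (n + 1)
      constructor
      · by_contra! hc
        nlinarith
      · linarith)
    (fun n => by
      rw [norm_smul, norm_inv, Real.norm_of_nonneg (ha n).le, inv_mul_le_iff₀ (ha n), mul_one]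
      exact hx n)
  have hy : ∀ n, x n - (⇑T)^[n] (x 0 - a 0 • v 0) = a n • v n := by
    intro n
    induction n with
    | zero => simp
    | succ n ih =>
      have h2 : (⇑T)^[n] (x 0 - a 0 • v 0) = x n - a n • v n := by rw [← ih]; abel
      have h3 := congrArg (fun w => a n • w) (hveq n)
      simp only [smul_sub, smul_smul, mul_inv_cancel₀ (ha n).ne', one_smul,
        mul_div_cancel₀ _ (ha n).ne'] at h3
      rw [Function.iterate_succ_apply', h2, map_sub, map_smul]
      rw [← sub_eq_zero] at h3 ⊢
      rw [← h3]
      abel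
  refine ⟨x 0 - a 0 • v 0, fun n => ?_⟩
  rw [hy, norm_smul, Real.norm_of_nonneg (ha n).le, mul_comm]
  exact mul_le_mul_of_nonneg_right (hv n) (ha n).le

/-- A pseudo orbit `x` starting and ending at `0`, supported in `[0, L)`, with errors bounded by a
weight `a` of variation at most `μ` which is `1` outside `(0, L)`. -/
structure IsBump {X : Type*} [NormedAddCommGroup X] (T : X → X) (μ : ℝ) (L : ℕ) (x : ℕ → X)
    (a : ℕ → ℝ) : Prop where
  length_pos : 0 < L
  orbit_zero : x 0 = 0
  orbit_of_le : ∀ i, L ≤ i → x i = 0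
  weight_zero : a 0 = 1
  weight_of_le : ∀ i, L ≤ i → a i = 1
  weight_pos : ∀ i, 0 < a i
  weight_succ_le : ∀ i, a (i + 1) ≤ μ * a i
  weight_le_succ : ∀ i, a i ≤ μ * a (i + 1)
  error_le : ∀ i, ‖T (x i) - x (i + 1)‖ ≤ a i

theorem isBump_zero {X : Type*} [NormedAddCommGroup X] [NormedSpace ℝ X] (T : X →L[ℝ] X) {μ : ℝ}
    (hμ : 1 < μ) : IsBump (⇑T) μ 1 0 1 := by
  constructor <;> simp [hμ.le]

/-- A dense orbit visits every nonempty open set at arbitrarily large times. -/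
theorem exists_lt_iterate_mem {X : Type*} [NormedAddCommGroup X] [NormedSpace ℝ X] {T : X → X}
    {h : X} (hd : Dense (Set.range fun n : ℕ => T^[n] h)) {V : Set X} (hV : IsOpen V)
    (hne : V.Nonempty) (m : ℕ) : ∃ n, m < n ∧ T^[n] h ∈ V := by
  rcases subsingleton_or_nontrivial X with hX | hX
  · obtain ⟨v, hv⟩ := hne
    exact ⟨m + 1, m.lt_succ_self, by rwa [Subsingleton.elim (T^[m + 1] h) v]⟩
  · have : ∀ x : X, (𝓝[≠] x).NeBot := fun x => Module.punctured_nhds_neBot ℝ X x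
    have hfin : ((fun n : ℕ => T^[n] h) '' Set.Iic m).Finite := (Set.finite_Iic m).image _
    obtain ⟨y, hyV, ⟨n, rfl⟩, hn⟩ := (hd.sdiff_finite hfin).inter_open_nonempty V hV hne
    refine ⟨n, ?_, hyV⟩
    by_contra! hc
    exact hn ⟨n, hc, rfl⟩

/-- Bumps through arbitrary vectors, with weight as small as desired at the summit. -/
theorem exists_isBump {X : Type*} [NormedAddCommGroup X] [NormedSpace ℝ X] {T : X →L[ℝ] X}
    {h : X} (hd : Dense (Set.range fun n : ℕ => (⇑T)^[n] h)) {μ : ℝ} (hμ : 1 < μ) (v : X)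
    {ε : ℝ} (hε : 0 < ε) :
    ∃ (L : ℕ) (x : ℕ → X) (a : ℕ → ℝ) (c : ℕ), IsBump (⇑T) μ L x a ∧ 0 < c ∧ c < L ∧
      ‖x c - v‖ < ε ∧ a c < ε := by
  have hμ0 : 0 < μ := one_pos.trans hμ
  have hρ0 : 0 < μ⁻¹ := inv_pos.2 hμ0
  have hρ1 : μ⁻¹ < 1 := inv_lt_one_of_one_lt₀ hμ
  obtain ⟨p, hp⟩ := exists_pow_lt_of_lt_one hε hρ1
  have hδ : 0 < μ⁻¹ ^ p := pow_pos hρ0 p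
  obtain ⟨i₁, -, h₁⟩ := exists_lt_iterate_mem hd (Metric.isOpen_ball (x := (0 : X)))
    ⟨0, Metric.mem_ball_self hδ⟩ 0
  obtain ⟨i₂, h₁₂, h₂⟩ := exists_lt_iterate_mem hd (Metric.isOpen_ball (x := v))
    ⟨v, Metric.mem_ball_self hε⟩ i₁
  obtain ⟨i₃, h₂₃, h₃⟩ := exists_lt_iterate_mem hd (Metric.isOpen_ball (x := (0 : X)))
    ⟨0, Metric.mem_ball_self hδ⟩ i₂
  obtain ⟨m, rfl⟩ := Nat.exists_eq_add_of_lt h₁₂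
  obtain ⟨q, rfl⟩ := Nat.exists_eq_add_of_lt h₂₃
  set w := (⇑T)^[i₁] h with hw
  rw [show i₁ + m + 1 = (m + 1) + i₁ by ring, Function.iterate_add_apply, ← hw] at h₂
  rw [show i₁ + m + 1 + q + 1 = (m + q + 2) + i₁ by ring, Function.iterate_add_apply, ← hw] at h₃
  rw [mem_ball_zero_iff] at h₁ h₃
  rw [mem_ball_iff_norm] at h₂
  let x : ℕ → X := fun i => if p + 1 ≤ i ∧ i < p + 1 + (m + q + 2) then (⇑T)^[i - (p + 1)] w else 0
  let τ : ℕ → ℕ := fun i => p - ((i - (p + m + 2)) + ((p + m + 2) - i))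
  have hpow : ∀ {k l : ℕ}, k ≤ l + 1 → μ⁻¹ ^ l ≤ μ * μ⁻¹ ^ k := by
    intro k l hkl
    calc μ⁻¹ ^ l = μ * μ⁻¹ ^ (l + 1) := by rw [pow_succ]; field_simp
      _ ≤ μ * μ⁻¹ ^ k := by
        gcongr μ * ?_
        exact pow_le_pow_of_le_one hρ0.le hρ1.le hkl
  refine ⟨p + 1 + (m + q + 2) + p, x, fun i => μ⁻¹ ^ τ i, p + m + 2,
    ⟨by omega, if_neg (by omega), fun i hi => if_neg (by omega), ?_, fun i hi => ?_,
      fun i => pow_pos hρ0 _, fun i => hpow ?_, fun i => hpow ?_, fun i => ?_⟩,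
    by omega, by omega, ?_, ?_⟩
  · rw [show τ 0 = 0 by simp only [τ]; omega, pow_zero]
  · rw [show τ i = 0 by simp only [τ]; omega, pow_zero]
  · simp only [τ]; omega
  · simp only [τ]; omega
  · have hle : μ⁻¹ ^ p ≤ μ⁻¹ ^ τ i :=
      pow_le_pow_of_le_one hρ0.le hρ1.le (by simp only [τ]; omega)
    refine le_trans ?_ hle
    rcases lt_trichotomy (i + 1) (p + 1) with hi | hi | hi
    · simp only [x]
      rw [if_neg (by omega), if_neg (by omega)]
      simpa using hδ.le
    · simp only [x]
      rw [if_neg (by omega), if_pos (by omega), hi]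
      simpa using h₁.le
    · rcases lt_trichotomy (i + 1) (p + 1 + (m + q + 2)) with hj | hj | hj
      · simp only [x]
        rw [if_pos (by omega), if_pos (by omega), ← Function.iterate_succ_apply' (⇑T),
          show (i - (p + 1)).succ = i + 1 - (p + 1) by omega]
        simpa using hδ.le
      · simp only [x]
        rw [if_pos (by omega), if_neg (by omega), ← Function.iterate_succ_apply' (⇑T),
          show (i - (p + 1)).succ = m + q + 2 by omega]
        simpa using h₃.le
      · simp only [x]
        rw [if_neg (by omega), if_neg (by omega)]
        simpa using hδ.le
  · simp only [x]
    rw [if_pos (by omega), show p + m + 2 - (p + 1) = m + 1 by omega]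
    exact h₂
  · simpa [τ] using hp

/-- The word number and the position in that word after `n` letters of a concatenation of words of
lengths `L 0, L 1, …`. -/
def concatIndex (L : ℕ → ℕ) : ℕ → ℕ × ℕ
  | 0 => (0, 0)
  | n + 1 =>
    if (concatIndex L n).2 + 1 < L (concatIndex L n).1 then
      ((concatIndex L n).1, (concatIndex L n).2 + 1)
    else ((concatIndex L n).1 + 1, 0)

theorem concatIndex_sum_add {L : ℕ → ℕ} (hL : ∀ k, 0 < L k) (k i : ℕ) (hi : i < L k) :
    concatIndex L (∑ j ∈ Finset.range k, L j + i) = (k, i) := by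
  induction k generalizing i with
  | zero =>
    induction i with
    | zero => simp [concatIndex]
    | succ i ih =>
      have := ih (by omega)
      rw [← add_assoc, concatIndex, this, if_pos hi]
  | succ k ihk =>
    induction i with
    | zero =>
      have := ihk (L k - 1) (by have := hL k; omega)
      rw [Finset.sum_range_succ, show ∑ j ∈ Finset.range k, L j + L k + 0 =
        ∑ j ∈ Finset.range k, L j + (L k - 1) + 1 by have := hL k; omega, concatIndex, this,
        if_neg (by simp only; omega)]
    | succ i ih =>
      have := ih (by omega)
      rw [← add_assoc, concatIndex, this, if_pos hi]

/-- A concatenation of bumps is shadowed with accuracy proportional to the weights. -/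
theorem IsBump.exists_shadowing_concat {X : Type*} [NormedAddCommGroup X] {T : X → X} {μ K : ℝ}
    (hshadow : ∀ (x : ℕ → X) (a : ℕ → ℝ), (∀ n, 0 < a n) →
      (∀ n, a (n + 1) ≤ μ * a n) → (∀ n, a n ≤ μ * a (n + 1)) →
      (∀ n, ‖T (x n) - x (n + 1)‖ ≤ a n) → ∃ z : X, ∀ n, ‖x n - T^[n] z‖ ≤ K * a n)
    {L : ℕ → ℕ} {x : ℕ → ℕ → X} {a : ℕ → ℕ → ℝ} (hb : ∀ k, IsBump T μ (L k) (x k) (a k)) :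
    ∃ z : X, ∀ k i, i < L k →
      ‖x k i - T^[∑ j ∈ Finset.range k, L j + i] z‖ ≤ K * a k i := by
  have hL : ∀ k, 0 < L k := fun k => (hb k).length_pos
  have key : ∀ n, x (concatIndex L (n + 1)).1 (concatIndex L (n + 1)).2 =
      x (concatIndex L n).1 ((concatIndex L n).2 + 1) ∧
      a (concatIndex L (n + 1)).1 (concatIndex L (n + 1)).2 =
      a (concatIndex L n).1 ((concatIndex L n).2 + 1) := by
    intro n
    rw [concatIndex]
    split_ifs with h
    · exact ⟨rfl, rfl⟩
    · rw [(hb _).orbit_zero, (hb _).weight_zero, (hb _).orbit_of_le _ (not_lt.1 h),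
        (hb _).weight_of_le _ (not_lt.1 h)]
      exact ⟨rfl, rfl⟩
  obtain ⟨z, hz⟩ := hshadow (fun n => x (concatIndex L n).1 (concatIndex L n).2)
    (fun n => a (concatIndex L n).1 (concatIndex L n).2)
    (fun n => (hb _).weight_pos _)
    (fun n => by simp only [(key n).2]; exact (hb _).weight_succ_le _)
    (fun n => by simp only [(key n).2]; exact (hb _).weight_le_succ _)
    (fun n => by simp only [(key n).1]; exact (hb _).error_le _)
  refine ⟨z, fun k i hi => ?_⟩
  have := hz (∑ j ∈ Finset.range k, L j + i)
  rwa [concatIndex_sum_add hL k i hi] at this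

theorem sum_padicValNat_two_le (k : ℕ) :
    ∑ i ∈ Finset.range k, padicValNat 2 (i + 1) ≤ k := by
  have h : ∑ i ∈ Finset.range k, padicValNat 2 (i + 1) = padicValNat 2 k.factorial := by
    induction k with
    | zero => simp
    | succ k ih =>
      rw [Finset.sum_range_succ, ih, Nat.factorial_succ,
        padicValNat.mul (Nat.succ_ne_zero k) k.factorial_ne_zero, add_comm]
  have h2 := sub_one_mul_padicValNat_factorial (p := 2) k
  omega

/-- A set containing an increasing sequence of at most linear growth has positive lower density. -/
theorem lowerDensity_pos_of_linear {A : Set ℕ} {p : ℕ → ℕ} {M : ℕ} (hp : Function.Injective p)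
    (hpos : ∀ i, 0 < p i) (hle : ∀ i, p i ≤ M * (i + 1)) (hA : ∀ i, p i ∈ A) :
    0 < lowerDensity A := by
  have hM : 0 < M := by
    have h1 := hle 0
    have h2 := hpos 0
    by_contra! hc
    obtain rfl : M = 0 := by omega
    omega
  have hMR : (0 : ℝ) < M := by exact_mod_cast hM
  have hcount : ∀ N, N / M ≤ (A ∩ Set.Icc 1 N).ncard := by
    intro N
    have hsub : p '' Set.Iio (N / M) ⊆ A ∩ Set.Icc 1 N := by
      rintro _ ⟨i, hi, rfl⟩
      refine ⟨hA i, hpos i, (hle i).trans ?_⟩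
      exact (Nat.mul_le_mul_left M hi).trans (Nat.mul_div_le N M)
    have hfin : (A ∩ Set.Icc 1 N).Finite := (Set.finite_Icc 1 N).subset Set.inter_subset_right
    have := Set.ncard_le_ncard hsub hfin
    rw [Set.ncard_image_of_injective _ hp, Set.ncard_eq_toFinset_card'] at this
    simpa using this
  refine lt_of_lt_of_le (by positivity : (0 : ℝ) < 1 / (2 * M)) ?_
  refine le_liminf_of_le ?_ ?_
  · refine IsBoundedUnder.isCoboundedUnder_ge ⟨1, eventually_map.2 (Eventually.of_forall fun N => ?_)⟩
    refine div_le_one_of_le₀ ?_ (Nat.cast_nonneg N)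
    have := Set.ncard_le_ncard (Set.inter_subset_right : A ∩ Set.Icc 1 N ⊆ Set.Icc 1 N)
      (Set.finite_Icc 1 N)
    rw [Set.ncard_eq_toFinset_card' (Set.Icc 1 N)] at this
    have h2 : (A ∩ Set.Icc 1 N).ncard ≤ N := by simpa using this
    exact_mod_cast h2
  · filter_upwards [eventually_ge_atTop (2 * M)] with N hN
    have hN0 : (0 : ℝ) < N := by exact_mod_cast (by omega : 0 < N)
    rw [div_le_div_iff₀ (by positivity) hN0]
    have h1 : N < M * (N / M + 1) := by
      have := Nat.lt_mul_div_succ N hM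
      simpa using this
    have h2 : N ≤ (A ∩ Set.Icc 1 N).ncard * (2 * M) := by
      have h3 := Nat.mul_le_mul_right (2 * M) (hcount N)
      nlinarith
    rw [one_mul]
    exact_mod_cast h2

/-- A hypercyclic operator with positive shadowing is frequently hypercyclic. -/
theorem exists_frequentlyHypercyclic {X : Type*} [NormedAddCommGroup X] [NormedSpace ℝ X]
    [CompleteSpace X] [TopologicalSpace.SeparableSpace X] {T : X →L[ℝ] X}
    {h : X} (hd : Dense (Set.range fun n : ℕ => (⇑T)^[n] h)) (hsh : PosShadowing (⇑T)) :
    ∃ z : X, ∀ V : Set X, IsOpen V → V.Nonempty →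
      0 < lowerDensity {n : ℕ | (⇑T)^[n] z ∈ V} := by
  obtain ⟨μ, K, hμ, hK, hshadow⟩ := hsh.exists_weighted_shadowing
  choose L x a c hb hc0 hcL hx ha using fun l : ℕ =>
    exists_isBump hd hμ (TopologicalSpace.denseSeq X l.unpair.1)
      (Nat.one_div_pos_of_nat (α := ℝ) (n := l.unpair.2))
  have hex : ∀ j : ℕ, ∃ (L' : ℕ) (x' : ℕ → X) (a' : ℕ → ℝ), IsBump (⇑T) μ L' x' a' ∧
      L' ≤ j + 1 ∧ (L j.unpair.1 ≤ j → L' = L j.unpair.1 ∧ x' = x j.unpair.1 ∧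
        a' = a j.unpair.1) := by
    intro j
    by_cases hj : L j.unpair.1 ≤ j
    · exact ⟨_, _, _, hb j.unpair.1, by omega, fun _ => ⟨rfl, rfl, rfl⟩⟩
    · exact ⟨1, 0, 1, isBump_zero T hμ, by omega, fun h => absurd h hj⟩
  choose L' x' a' hb' hL' heq using hex
  obtain ⟨z, hz⟩ := IsBump.exists_shadowing_concat hshadow
    (fun k => hb' (padicValNat 2 (k + 1)))
  refine ⟨z, fun V hV ⟨v, hv⟩ => ?_⟩
  obtain ⟨r, hr, hrV⟩ := Metric.isOpen_iff.1 hV v hv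
  obtain ⟨q, hq⟩ := exists_nat_one_div_lt (show 0 < r / (2 * (1 + K)) by positivity)
  obtain ⟨_, hs, ⟨s, rfl⟩⟩ := Metric.dense_iff.1 (TopologicalSpace.denseRange_denseSeq X) v (r / 2)
    (by positivity)
  set l := Nat.pair s q with hl
  set j := Nat.pair l (L l) with hj
  have hjl : j.unpair.1 = l := by rw [hj, Nat.unpair_pair]
  obtain ⟨hLj, hxj, haj⟩ := heq j (by rw [hjl]; exact Nat.right_le_pair _ _)
  rw [hjl] at hLj hxj haj
  have hxl := hx l
  have hal := ha l
  rw [hl, Nat.unpair_pair, ← hl] at hxl hal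
  simp only at hxl hal
  set b : ℕ → ℕ := fun k => ∑ i ∈ Finset.range k, L' (padicValNat 2 (i + 1)) with hbdef
  have hbmono : StrictMono b := strictMono_nat_of_lt_succ fun k => by
    simp only [hbdef, Finset.sum_range_succ]
    have := (hb' (padicValNat 2 (k + 1))).length_pos
    omega
  have hble : ∀ k, b k ≤ 2 * k := fun k => by
    calc b k ≤ ∑ i ∈ Finset.range k, (padicValNat 2 (i + 1) + 1) :=
          Finset.sum_le_sum fun i _ => hL' _
      _ ≤ 2 * k := by
        rw [Finset.sum_add_distrib]
        have := sum_padicValNat_two_le k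
        simp only [Finset.sum_const, Finset.card_range, smul_eq_mul, mul_one]
        omega
  have h2j : 0 < 2 ^ j := by positivity
  have hkval : ∀ i, padicValNat 2 (2 ^ j * (2 * i + 1) - 1 + 1) = j := by
    intro i
    rw [Nat.sub_add_cancel (Nat.one_le_iff_ne_zero.2 (by positivity)),
      padicValNat.mul (by positivity) (by omega), padicValNat.prime_pow,
      padicValNat.eq_zero_of_not_dvd (by omega), add_zero]
  have hkmono : StrictMono fun i => 2 ^ j * (2 * i + 1) - 1 := strictMono_nat_of_lt_succ fun i => by
    have : 2 ^ j * (2 * (i + 1) + 1) = 2 ^ j * (2 * i + 1) + 2 * 2 ^ j := by ring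
    omega
  refine lowerDensity_pos_of_linear (p := fun i => b (2 ^ j * (2 * i + 1) - 1) + c l)
    (M := 4 * 2 ^ j + c l) ?_ (fun i => ?_) (fun i => ?_) (fun i => ?_)
  · exact ((hbmono.comp hkmono).add_const _).injective
  · have := hc0 l
    omega
  · have h1 := hble (2 ^ j * (2 * i + 1) - 1)
    have h2 : 2 * (2 ^ j * (2 * i + 1) - 1) ≤ 4 * 2 ^ j * (i + 1) := by
      have : 2 * (2 ^ j * (2 * i + 1)) + 2 * 2 ^ j = 4 * 2 ^ j * (i + 1) := by ring
      omega
    have h3 : c l ≤ c l * (i + 1) := Nat.le_mul_of_pos_right _ (by omega)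
    rw [add_mul]
    omega
  · apply hrV
    have h1 := hz (2 ^ j * (2 * i + 1) - 1) (c l) (by rw [hkval, hLj]; exact hcL l)
    simp only [hkval, hxj, haj] at h1
    rw [Metric.mem_ball, dist_eq_norm]
    rw [Metric.mem_ball, dist_eq_norm] at hs
    set y := (⇑T)^[b (2 ^ j * (2 * i + 1) - 1) + c l] z
    change ‖x l (c l) - y‖ ≤ _ at h1
    have h2 : K * a l (c l) ≤ K * (1 / ((q : ℝ) + 1)) := by gcongr
    have h3 : (1 + K) * (1 / ((q : ℝ) + 1)) < r / 2 := by
      rw [lt_div_iff₀ (by positivity)] at hq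
      linarith
    have h4 : y - v = -(x l (c l) - y) + (x l (c l) - TopologicalSpace.denseSeq X s) +
      (TopologicalSpace.denseSeq X s - v) := by abel
    calc ‖y - v‖ ≤ ‖x l (c l) - y‖ + ‖x l (c l) - TopologicalSpace.denseSeq X s‖ +
          ‖TopologicalSpace.denseSeq X s - v‖ := by
            rw [h4]
            exact norm_add₃_le.trans (by rw [norm_neg])
      _ < r := by linarith

/-- A hypercyclic operator with positive shadowing is topologically mixing. -/
theorem exists_forall_image_iterate_inter_nonempty {X : Type*} [NormedAddCommGroup X]
    [NormedSpace ℝ X] [CompleteSpace X] {T : X →L[ℝ] X}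
    {h : X} (hd : Dense (Set.range fun n : ℕ => (⇑T)^[n] h)) (hsh : PosShadowing (⇑T))
    {U V : Set X} (hU : IsOpen U) (hV : IsOpen V) (hUne : U.Nonempty) (hVne : V.Nonempty) :
    ∃ N : ℕ, ∀ n > N, ((⇑T)^[n] '' U ∩ V).Nonempty := by
  obtain ⟨μ, K, hμ, hK, hshadow⟩ := hsh.exists_weighted_shadowing
  have key : ∀ W : Set X, IsOpen W → W.Nonempty → ∃ (L : ℕ) (x : ℕ → X) (a : ℕ → ℝ) (c : ℕ),
      IsBump (⇑T) μ L x a ∧ c < L ∧ ∀ y, ‖x c - y‖ ≤ K * a c → y ∈ W := by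
    rintro W hW ⟨v, hv⟩
    obtain ⟨r, hr, hrW⟩ := Metric.isOpen_iff.1 hW v hv
    obtain ⟨L, x, a, c, hb, -, hc, hx, ha⟩ :=
      exists_isBump hd hμ v (show 0 < r / (1 + K) by positivity)
    refine ⟨L, x, a, c, hb, hc, fun y hy => hrW ?_⟩
    rw [Metric.mem_ball', dist_eq_norm]
    have h2 : K * a c ≤ K * (r / (1 + K)) := by gcongr
    have h3 : r / (1 + K) + K * (r / (1 + K)) = r := by field_simp
    calc ‖v - y‖ = ‖-(x c - v) + (x c - y)‖ := by congr 1; abel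
      _ ≤ ‖x c - v‖ + ‖x c - y‖ := (norm_add_le _ _).trans (by rw [norm_neg])
      _ < r := by linarith
  obtain ⟨L, x, a, c, hb, hc, hmem⟩ := key U hU hUne
  obtain ⟨L', x', a', c', hb', hc', hmem'⟩ := key V hV hVne
  refine ⟨L + c', fun n hn => ?_⟩
  let M := n + c - c' - L
  have hex : ∀ k : ℕ, ∃ (l : ℕ) (y : ℕ → X) (s : ℕ → ℝ), IsBump (⇑T) μ l y s ∧
      (k = 0 → l = L ∧ y = x ∧ s = a) ∧ (k = M + 1 → l = L' ∧ y = x' ∧ s = a') ∧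
      (k ≠ 0 → k ≠ M + 1 → l = 1) := by
    intro k
    by_cases h0 : k = 0
    · exact ⟨L, x, a, hb, fun _ => ⟨rfl, rfl, rfl⟩, fun h => by omega, fun h => absurd h0 h⟩
    · by_cases h1 : k = M + 1
      · exact ⟨L', x', a', hb', fun h => absurd h h0, fun _ => ⟨rfl, rfl, rfl⟩,
          fun _ h => absurd h1 h⟩
      · exact ⟨1, 0, 1, isBump_zero T hμ, fun h => absurd h h0, fun h => absurd h h1,
          fun _ _ => rfl⟩
  choose l y s hbump hfirst hsecond hrest using hex
  obtain ⟨z, hz⟩ := IsBump.exists_shadowing_concat hshadow hbump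
  obtain ⟨hl0, hy0, hs0⟩ := hfirst 0 rfl
  obtain ⟨hl1, hy1, hs1⟩ := hsecond (M + 1) rfl
  have hz0 := hz 0 c (by rw [hl0]; exact hc)
  have hz1 := hz (M + 1) c' (by rw [hl1]; exact hc')
  have hsum : ∑ k ∈ Finset.range (M + 1), l k = L + M := by
    rw [Finset.sum_range_succ', hl0, Finset.sum_congr rfl (g := fun _ => 1) fun k hk =>
      hrest (k + 1) (by omega) (by have := Finset.mem_range.1 hk; omega)]
    simp [add_comm]
  rw [Finset.sum_range_zero, zero_add, hy0, hs0] at hz0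
  rw [hsum, hy1, hs1, show L + M + c' = n + c by omega, Function.iterate_add_apply] at hz1
  exact ⟨_, ⟨_, hmem _ hz0, rfl⟩, hmem' _ hz1⟩

/-- A hypercyclic operator with the positive shadowing property on a separable Banach
space is frequently hypercyclic and topologically mixing. -/
theorem stmt_16 {𝕜 : Type*} [RCLike 𝕜] {X : Type*} [NormedAddCommGroup X]
    [NormedSpace 𝕜 X] [CompleteSpace X] [TopologicalSpace.SeparableSpace X]
    (T : X →L[𝕜] X)
    (hhc : ∃ x : X, Dense (Set.range fun n : ℕ => (⇑T)^[n] x))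
    (hsh : PosShadowing (⇑T)) :
    (∃ z : X, ∀ V : Set X, IsOpen V → V.Nonempty →
      0 < lowerDensity {n : ℕ | (⇑T)^[n] z ∈ V}) ∧
    (∀ U V : Set X, IsOpen U → IsOpen V → U.Nonempty → V.Nonempty →
      ∃ N : ℕ, ∀ n > N, ((⇑T)^[n] '' U ∩ V).Nonempty) := by
  obtain ⟨h, hd⟩ := hhc
  obtain ⟨_, _⟩ : ∃ _ : NormedSpace ℝ X, IsScalarTower ℝ 𝕜 X :=
    ⟨NormedSpace.restrictScalars ℝ 𝕜 X, RestrictScalars.isScalarTower ℝ 𝕜 X⟩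
  have hT : ⇑(T.restrictScalars ℝ) = ⇑T := rfl
  rw [← hT] at hd hsh ⊢
  exact ⟨exists_frequentlyHypercyclic hd hsh, fun _ _ hU hV hUne hVne =>
    exists_forall_image_iterate_inter_nonempty hd hsh hU hV hUne hVne⟩
end

section
/- Let X be a Banach space over ℝ or ℂ and T : X → X a bounded linear operator. Suppose X = M ⊕ N where M and N are closed T-invariant linear subspaces of X. Then T has the positive shadowing property if and only if both restrictions T|_M : M → M and T|_N : N → N have the positive shadowing property. -/
theorem PosShadowing.of_semiconj {𝕜 E F : Type*} [NontriviallyNormedField 𝕜]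
    [NormedAddCommGroup E] [NormedSpace 𝕜 E] [NormedAddCommGroup F] [NormedSpace 𝕜 F]
    {S : E → E} {T : F → F} (e : E ≃L[𝕜] F) (h : Function.Semiconj e S T)
    (hS : PosShadowing S) : PosShadowing T := by
  intro ε hε
  obtain ⟨C, hC, hCe⟩ := (e : E →L[𝕜] F).bound
  obtain ⟨D, hD, hDe⟩ := (e.symm : F →L[𝕜] E).bound
  obtain ⟨δ, hδ, hsh⟩ := hS (ε / C) (by positivity)
  refine ⟨δ / D, by positivity, fun x hx => ?_⟩
  have hinv : Function.Semiconj e.symm T S :=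
    fun y => e.injective (by rw [h, e.apply_symm_apply, e.apply_symm_apply])
  obtain ⟨z, hz⟩ := hsh (fun n => e.symm (x n)) fun n => by
    rw [← hinv, ← map_sub]
    calc ‖e.symm (T (x n) - x (n + 1))‖ ≤ D * ‖T (x n) - x (n + 1)‖ := hDe _
      _ ≤ D * (δ / D) := by gcongr; exact hx n
      _ = δ := by field_simp
  refine ⟨e z, fun n => ?_⟩
  rw [← h.iterate_right n z]
  calc ‖x n - e (S^[n] z)‖ = ‖e (e.symm (x n) - S^[n] z)‖ := by simp
    _ ≤ C * ‖e.symm (x n) - S^[n] z‖ := hCe _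
    _ < C * (ε / C) := by gcongr; exact hz n
    _ = ε := by field_simp

theorem posShadowing_prodMap_iff {E F : Type*} [NormedAddCommGroup E] [NormedAddCommGroup F]
    {S : E → E} {T : F → F} :
    PosShadowing (Prod.map S T) ↔ PosShadowing S ∧ PosShadowing T := by
  refine ⟨fun h => ⟨fun ε hε => ?_, fun ε hε => ?_⟩, fun ⟨hS, hT⟩ ε hε => ?_⟩
  · obtain ⟨δ, hδ, hsh⟩ := h ε hε
    refine ⟨δ, hδ, fun x hx => ?_⟩
    obtain ⟨z, hz⟩ := hsh (fun n => (x n, T^[n] 0)) fun n => by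
      simpa [Prod.norm_def, ← Function.iterate_succ_apply', hδ.le] using hx n
    refine ⟨z.1, fun n => (norm_fst_le (_, T^[n] 0 - T^[n] z.2)).trans_lt ?_⟩
    simpa [Prod.map_iterate, Prod.norm_def] using hz n
  · obtain ⟨δ, hδ, hsh⟩ := h ε hε
    refine ⟨δ, hδ, fun x hx => ?_⟩
    obtain ⟨z, hz⟩ := hsh (fun n => (S^[n] 0, x n)) fun n => by
      simpa [Prod.norm_def, ← Function.iterate_succ_apply', hδ.le] using hx n
    refine ⟨z.2, fun n => (norm_snd_le (S^[n] 0 - S^[n] z.1, _)).trans_lt ?_⟩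
    simpa [Prod.map_iterate, Prod.norm_def] using hz n
  · obtain ⟨δ₁, hδ₁, h₁⟩ := hS ε hε
    obtain ⟨δ₂, hδ₂, h₂⟩ := hT ε hε
    refine ⟨min δ₁ δ₂, lt_min hδ₁ hδ₂, fun x hx => ?_⟩
    obtain ⟨z₁, hz₁⟩ := h₁ (fun n => (x n).1) fun n =>
      (norm_fst_le _).trans ((hx n).trans (min_le_left _ _))
    obtain ⟨z₂, hz₂⟩ := h₂ (fun n => (x n).2) fun n =>
      (norm_snd_le _).trans ((hx n).trans (min_le_right _ _))
    refine ⟨(z₁, z₂), fun n => ?_⟩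
    rw [Prod.map_iterate]
    exact max_lt (hz₁ n) (hz₂ n)

theorem stmt_18 {𝕜 : Type*} [RCLike 𝕜] {X : Type*} [NormedAddCommGroup X]
    [NormedSpace 𝕜 X] [CompleteSpace X] (T : X →L[𝕜] X) (M N : Submodule 𝕜 X)
    (hMc : IsClosed (M : Set X)) (hNc : IsClosed (N : Set X))
    (hMi : ∀ x ∈ M, T x ∈ M) (hNi : ∀ x ∈ N, T x ∈ N)
    (hcompl : IsCompl M N) :
    PosShadowing (⇑T) ↔
      PosShadowing (fun m : M => (⟨T m, hMi m m.2⟩ : M)) ∧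
      PosShadowing (fun n : N => (⟨T n, hNi n n.2⟩ : N)) := by
  let e := M.prodEquivOfIsTopCompl N (Submodule.IsCompl.isTopCompl_of_isClosed hcompl hMc hNc)
  have he : Function.Semiconj e
      (Prod.map (fun m : M => (⟨T m, hMi m m.2⟩ : M)) (fun n : N => (⟨T n, hNi n n.2⟩ : N))) T :=
    fun x => by simp [e]
  rw [← posShadowing_prodMap_iff]
  exact ⟨.of_semiconj e.symm fun y => e.injective (by simp [he.eq]), .of_semiconj e he⟩
end

section
/- Let X be a non-trivial separable Hilbert space over ℝ or ℂ and T : X → X a unitary operator. Then T does not have the positive shadowing property. -/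
/-- A unitary operator (a surjective linear isometry) on a non-trivial separable Hilbert
space does not have the positive shadowing property. -/
theorem stmt_19 {𝕜 : Type*} [RCLike 𝕜] {X : Type*} [NormedAddCommGroup X]
    [InnerProductSpace 𝕜 X] [CompleteSpace X] [TopologicalSpace.SeparableSpace X]
    [Nontrivial X] (T : X →L[𝕜] X)
    (hsurj : Function.Surjective (⇑T)) (hiso : ∀ x : X, ‖T x‖ = ‖x‖) :
    ¬ PosShadowing (⇑T) := by
  intro h
  obtain ⟨δ, hδ, H⟩ := h 1 one_pos
  obtain ⟨v, hv⟩ : ∃ v : X, ‖v‖ = δ := by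
    obtain ⟨u, hu⟩ := exists_ne (0 : X)
    refine ⟨((δ / ‖u‖ : ℝ) : 𝕜) • u, ?_⟩
    have hu' : ‖u‖ ≠ 0 := norm_ne_zero_iff.mpr hu
    rw [norm_smul, RCLike.norm_ofReal, abs_of_nonneg (by positivity), div_mul_cancel₀ _ hu']
  have hiter (n : ℕ) (a b : X) : ‖T^[n] a - T^[n] b‖ = ‖a - b‖ := by
    induction n with
    | zero => rfl
    | succ n ih => rw [Function.iterate_succ_apply', Function.iterate_succ_apply', ← map_sub,
        hiso, ih]
  -- The pseudo orbit `T^[n] (n • v)` drifts away from every orbit at linear speed.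
  obtain ⟨z, hz⟩ := H (fun n ↦ T^[n] (n • v)) fun n ↦ by
    simp only [← Function.iterate_succ_apply' T n, hiter]
    rw [succ_nsmul, sub_add_cancel_left, norm_neg, hv]
  obtain ⟨n, hn⟩ := exists_nat_gt ((1 + ‖z‖) / δ)
  have hlt : ‖n • v - z‖ < 1 := by simpa only [hiter] using hz n
  have hnorm : ‖n • v‖ = n * δ := by
    rw [← Nat.cast_smul_eq_nsmul 𝕜, norm_smul, RCLike.norm_natCast, hv]
  have htri := norm_sub_norm_le (n • v) z
  rw [div_lt_iff₀ hδ] at hn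
  linarith
end
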